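/- arXiv:2011.06389 — 2 statements merged into one kernel-verified Lean document; each statement's English description precedes it below -/
import Mathlib

section
/- Let 1 < α < 2 and let b_0, b_1, b_2, r_0, r_1, r_2 be real numbers with b_1 ≥ 0, b_2 ≥ 0, b_0 = b_1/2 + Γ(α)·b_2, such that r_1 = r_0 + 1 whenever b_1 > 0 and r_2 = r_0 + α − 1 whenever b_2 > 0. Then for every u > 0, −b_0·u^{r_0−1} + (1/2)·b_1·u^{r_1−2} + b_2·u^{r_2} · ∫_0^∞ z^2 · (∫_0^1 (u+v·z)^{−2}·(1−v) dv) dμ_α(z) = 0. -/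
open MeasureTheory

/-- `K_ρ(u,z) := (ln(u+z)/ln u)^{-ρ} + ρ·(ln(u+z)/ln u) − (ρ+1)`. -/
noncomputable def Kfun (ρ u z : ℝ) : ℝ :=
  (Real.log (u + z) / Real.log u) ^ (-ρ) + ρ * (Real.log (u + z) / Real.log u) - (ρ + 1)

/-- The `α`-stable measure on `(0,∞)` with density
`z ↦ (α(α−1)/Γ(2−α))·z^{−1−α}` with respect to Lebesgue measure. -/
noncomputable def muAlpha (α : ℝ) : Measure ℝ :=
  (volume.withDensity
    (fun z => ENNReal.ofReal ((α * (α - 1) / Real.Gamma (2 - α)) * z ^ (-1 - α)))).restrict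
    (Set.Ioi 0)


lemma aux_gamma (a r : ℝ) (ha : 0 < a) (hr : 0 < r) :
    ∫⁻ t in Set.Ioi (0:ℝ), ENNReal.ofReal (t ^ (a - 1) * Real.exp (-(r * t)))
      = ENNReal.ofReal ((1 / r) ^ a * Real.Gamma a) := by
  have h := Real.integral_rpow_mul_exp_neg_mul_Ioi ha hr
  have hpos : 0 < (1 / r) ^ a * Real.Gamma a :=
    mul_pos (Real.rpow_pos_of_pos (by positivity) _) (Real.Gamma_pos_of_pos ha)
  rw [← h, ofReal_integral_eq_lintegral_ofReal]
  · by_contra hn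
    rw [integral_undef hn] at h
    linarith
  · refine (ae_restrict_iff' measurableSet_Ioi).2 (Filter.Eventually.of_forall fun t ht => ?_)
    have ht' : (0:ℝ) < t := ht
    show (0:ℝ) ≤ _
    positivity

lemma aux_beta (α u v : ℝ) (hα1 : 1 < α) (hα2 : α < 2) (hu : 0 < u) (hv : 0 < v) :
    ∫⁻ z in Set.Ioi (0:ℝ), ENNReal.ofReal (z ^ (1 - α) * (u + v * z) ^ (-2 : ℝ))
      = ENNReal.ofReal (Real.Gamma (2 - α) * Real.Gamma α * u ^ (-α) * v ^ (α - 2)) := by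
  have h1 : ∀ z ∈ Set.Ioi (0:ℝ), ENNReal.ofReal (z ^ (1 - α) * (u + v * z) ^ (-2 : ℝ))
      = ∫⁻ s in Set.Ioi (0:ℝ),
          ENNReal.ofReal (z ^ (1 - α) * (s * Real.exp (-((u + v * z) * s)))) := by
    intro z hz
    have hz' : (0:ℝ) < z := hz
    have hr : 0 < u + v * z := by positivity
    have := aux_gamma 2 (u + v * z) two_pos hr
    have h2 : ∀ s : ℝ, s ^ ((2:ℝ) - 1) = s := by
      intro s; norm_num
    simp only [h2, Real.Gamma_two, mul_one] at this
    simp_rw [ENNReal.ofReal_mul (Real.rpow_nonneg hz'.le (1 - α))]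
    rw [lintegral_const_mul _ (by fun_prop), this, one_div, Real.inv_rpow hr.le,
      Real.rpow_neg hr.le]
  rw [setLIntegral_congr_fun measurableSet_Ioi h1]
  rw [lintegral_lintegral_swap (by
    apply Measurable.aemeasurable
    unfold Function.uncurry
    fun_prop)]
  have h3 : ∀ s ∈ Set.Ioi (0:ℝ), ∫⁻ z in Set.Ioi (0:ℝ),
          ENNReal.ofReal (z ^ (1 - α) * (s * Real.exp (-((u + v * z) * s))))
      = ENNReal.ofReal (Real.Gamma (2 - α) * v ^ (α - 2)) *
          ENNReal.ofReal (s ^ (α - 1) * Real.exp (-(u * s))) := by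
    intro s hs
    have hs' : (0:ℝ) < s := hs
    have := aux_gamma (2 - α) (v * s) (by linarith) (by positivity)
    have h4 : ∀ z : ℝ, z ^ (1 - α) * (s * Real.exp (-((u + v * z) * s)))
        = (s * Real.exp (-(u * s))) * (z ^ (2 - α - 1) * Real.exp (-(v * s * z))) := by
      intro z
      have : -((u + v * z) * s) = -(u * s) + -(v * s * z) := by ring
      rw [this, Real.exp_add]
      have : 2 - α - 1 = 1 - α := by ring
      rw [this]; ring
    simp_rw [h4]
    simp_rw [ENNReal.ofReal_mul (show 0 ≤ s * Real.exp (-(u * s)) by positivity)]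
    rw [lintegral_const_mul _ (by fun_prop), this]
    have hG := Real.Gamma_pos_of_pos (show 0 < 2 - α by linarith)
    rw [← ENNReal.ofReal_mul (by positivity), ← ENNReal.ofReal_mul (by positivity)]
    congr 1
    rw [one_div, Real.inv_rpow (by positivity), ← Real.rpow_neg (by positivity),
      Real.mul_rpow hv.le hs'.le]
    have e1 : -(2 - α) = α - 2 := by ring
    have e2 : s ^ (α - 1) = s ^ (α - 2) * s := by
      rw [← Real.rpow_add_one hs'.ne']; congr 1; ring
    rw [e1, e2]; ring
  rw [setLIntegral_congr_fun measurableSet_Ioi h3]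
  rw [lintegral_const_mul _ (by fun_prop), aux_gamma α u (by linarith) hu]
  have hG := Real.Gamma_pos_of_pos (show 0 < 2 - α by linarith)
  rw [← ENNReal.ofReal_mul (by positivity)]
  congr 1
  rw [one_div, Real.inv_rpow hu.le, ← Real.rpow_neg hu.le]
  ring

lemma aux_v (α : ℝ) (hα1 : 1 < α) :
    ∫⁻ v in Set.Ioc (0:ℝ) 1, ENNReal.ofReal (v ^ (α - 2) * (1 - v))
      = ENNReal.ofReal (1 / (α * (α - 1))) := by
  have i1 : IntervalIntegrable (fun v : ℝ => v ^ (α - 2)) volume 0 1 :=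
    intervalIntegral.intervalIntegrable_rpow' (by linarith)
  have i2 : IntervalIntegrable (fun v : ℝ => v ^ (α - 1)) volume 0 1 :=
    intervalIntegral.intervalIntegrable_rpow' (by linarith)
  have hint : ∫ v in (0:ℝ)..1, (v ^ (α - 2) - v ^ (α - 1)) = 1 / (α * (α - 1)) := by
    rw [intervalIntegral.integral_sub i1 i2, integral_rpow (Or.inl (by linarith)),
      integral_rpow (Or.inl (by linarith))]
    have e1 : α - 2 + 1 = α - 1 := by ring
    have e2 : α - 1 + 1 = α := by ring
    rw [e1, e2, Real.one_rpow, Real.one_rpow, Real.zero_rpow (by linarith),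
      Real.zero_rpow (by linarith)]
    have : α ≠ 0 := by linarith
    have : α - 1 ≠ 0 := by linarith
    field_simp
    ring
  have heq : ∀ v ∈ Set.Ioc (0:ℝ) 1, ENNReal.ofReal (v ^ (α - 2) * (1 - v))
      = ENNReal.ofReal (v ^ (α - 2) - v ^ (α - 1)) := by
    intro v hv
    have e2 : v ^ (α - 1) = v ^ (α - 2) * v := by
      rw [← Real.rpow_add_one hv.1.ne']; congr 1; ring
    rw [e2]; congr 1; ring
  rw [setLIntegral_congr_fun measurableSet_Ioc heq, ← hint,
    intervalIntegral.integral_of_le zero_le_one, ofReal_integral_eq_lintegral_ofReal]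
  · exact (intervalIntegrable_iff_integrableOn_Ioc_of_le zero_le_one).1 (i1.sub i2)
  · refine (ae_restrict_iff' measurableSet_Ioc).2 (Filter.Eventually.of_forall fun v hv => ?_)
    show (0:ℝ) ≤ _
    have := Real.rpow_le_rpow_of_exponent_ge hv.1 hv.2 (show α - 2 ≤ α - 1 by linarith)
    linarith

lemma aux_main (α u : ℝ) (hα1 : 1 < α) (hα2 : α < 2) (hu : 0 < u) :
    ∫ z in Set.Ioi (0 : ℝ),
      z ^ 2 * (∫ v in (0 : ℝ)..1, (u + v * z) ^ (-2 : ℝ) * (1 - v)) ∂(muAlpha α)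
      = Real.Gamma α * u ^ (-α) := by
  have hG := Real.Gamma_pos_of_pos (show 0 < 2 - α by linarith)
  have hG' := Real.Gamma_pos_of_pos (show 0 < α by linarith)
  have hα : 0 < α - 1 := by linarith
  set c := α * (α - 1) / Real.Gamma (2 - α) with hc
  have hcpos : 0 < c := by positivity
  have hnn : ∀ z : ℝ, 0 < z → ∀ v ∈ Set.Ioc (0:ℝ) 1,
      0 ≤ (u + v * z) ^ (-2 : ℝ) * (1 - v) := by
    intro z hz v hv
    have := hv.1
    exact mul_nonneg (Real.rpow_nonneg (by positivity) _) (by linarith [hv.2])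
  simp_rw [intervalIntegral.integral_of_le (zero_le_one (α := ℝ))]
  have hmeas : Measurable fun z : ℝ =>
      ∫ v in Set.Ioc (0:ℝ) 1, (u + v * z) ^ (-2 : ℝ) * (1 - v) := by
    apply StronglyMeasurable.measurable
    apply StronglyMeasurable.integral_prod_right
      (f := fun (z v : ℝ) => (u + v * z) ^ (-2 : ℝ) * (1 - v))
    apply Measurable.stronglyMeasurable
    unfold Function.uncurry
    fun_prop
  have hinner : ∀ z : ℝ, 0 < z →
      0 ≤ ∫ v in Set.Ioc (0:ℝ) 1, (u + v * z) ^ (-2 : ℝ) * (1 - v) := fun z hz =>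
    setIntegral_nonneg measurableSet_Ioc (hnn z hz)
  unfold muAlpha
  rw [Measure.restrict_restrict measurableSet_Ioi, Set.inter_self,
    restrict_withDensity measurableSet_Ioi, integral_eq_lintegral_of_nonneg_ae]
  rotate_left
  · apply (withDensity_absolutelyContinuous _ _).ae_le
    refine (ae_restrict_iff' measurableSet_Ioi).2 (Filter.Eventually.of_forall fun z hz => ?_)
    exact mul_nonneg (sq_nonneg z) (hinner z hz)
  · exact ((measurable_id.pow_const 2).mul hmeas).aestronglyMeasurable
  have hmeas2 : Measurable fun z : ℝ => ENNReal.ofReal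
      (z ^ 2 * ∫ v in Set.Ioc (0:ℝ) 1, (u + v * z) ^ (-2 : ℝ) * (1 - v)) :=
    ((measurable_id.pow_const 2).mul hmeas).ennreal_ofReal
  rw [lintegral_withDensity_eq_lintegral_mul _ (by fun_prop) hmeas2]
  have h1 : ∀ z ∈ Set.Ioi (0:ℝ),
      ((fun z : ℝ => ENNReal.ofReal (c * z ^ (-1 - α))) * fun z : ℝ => ENNReal.ofReal
        (z ^ 2 * ∫ v in Set.Ioc (0:ℝ) 1, (u + v * z) ^ (-2 : ℝ) * (1 - v))) z
      = ∫⁻ v in Set.Ioc (0:ℝ) 1,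
          ENNReal.ofReal (c * z ^ (1 - α) * ((u + v * z) ^ (-2 : ℝ) * (1 - v))) := by
    intro z hz
    have hz' : (0:ℝ) < z := hz
    simp_rw [ENNReal.ofReal_mul (show 0 ≤ c * z ^ (1 - α) by positivity)]
    rw [lintegral_const_mul _ (by fun_prop), ← ofReal_integral_eq_lintegral_ofReal,
      Pi.mul_apply, ← ENNReal.ofReal_mul (by positivity), ← ENNReal.ofReal_mul (by positivity)]
    · congr 1
      have : z ^ (1 - α) = z ^ (-1 - α) * z ^ 2 := by
        rw [← Real.rpow_natCast z 2, ← Real.rpow_add hz']; congr 1; push_cast; ring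
      rw [this]; ring
    · apply IntegrableOn.mono_set (t := Set.Icc 0 1) _ Set.Ioc_subset_Icc_self
      apply ContinuousOn.integrableOn_Icc
      apply ContinuousOn.mul _ (by fun_prop)
      apply ContinuousOn.rpow_const (by fun_prop)
      intro v hv
      left
      have := hv.1
      positivity
    · exact (ae_restrict_iff' measurableSet_Ioc).2 (Filter.Eventually.of_forall (hnn z hz'))
  rw [setLIntegral_congr_fun measurableSet_Ioi h1]
  rw [lintegral_lintegral_swap (by
    apply Measurable.aemeasurable
    unfold Function.uncurry
    fun_prop)]
  have h2 : ∀ v ∈ Set.Ioc (0:ℝ) 1, ∫⁻ z in Set.Ioi (0:ℝ),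
          ENNReal.ofReal (c * z ^ (1 - α) * ((u + v * z) ^ (-2 : ℝ) * (1 - v)))
      = ENNReal.ofReal (c * (Real.Gamma (2 - α) * Real.Gamma α * u ^ (-α))) *
          ENNReal.ofReal (v ^ (α - 2) * (1 - v)) := by
    intro v hv
    have hv0 := hv.1
    have hv1 : 0 ≤ 1 - v := by linarith [hv.2]
    have e : ∀ z : ℝ, c * z ^ (1 - α) * ((u + v * z) ^ (-2 : ℝ) * (1 - v))
        = (c * (1 - v)) * (z ^ (1 - α) * (u + v * z) ^ (-2 : ℝ)) := by
      intro z; ring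
    simp_rw [e, ENNReal.ofReal_mul (show 0 ≤ c * (1 - v) by positivity)]
    rw [lintegral_const_mul _ (by fun_prop), aux_beta α u v hα1 hα2 hu hv0,
      ← ENNReal.ofReal_mul (by positivity), ← ENNReal.ofReal_mul (by positivity)]
    congr 1; ring
  rw [setLIntegral_congr_fun measurableSet_Ioc h2]
  rw [lintegral_const_mul _ (by fun_prop), aux_v α hα1, ← ENNReal.ofReal_mul (by positivity),
    ENNReal.toReal_ofReal (by positivity), hc]
  field_simp

theorem stmt_9 (α b₀ b₁ b₂ r₀ r₁ r₂ : ℝ) (hα1 : 1 < α) (hα2 : α < 2)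
    (hb₁ : 0 ≤ b₁) (hb₂ : 0 ≤ b₂) (hb₀ : b₀ = b₁ / 2 + Real.Gamma α * b₂)
    (hr₁ : 0 < b₁ → r₁ = r₀ + 1) (hr₂ : 0 < b₂ → r₂ = r₀ + α - 1) :
    ∀ u : ℝ, 0 < u →
      -b₀ * u ^ (r₀ - 1) + (1 / 2) * b₁ * u ^ (r₁ - 2)
          + b₂ * u ^ r₂ *
            ∫ z in Set.Ioi (0 : ℝ),
              z ^ 2 * (∫ v in (0 : ℝ)..1, (u + v * z) ^ (-2 : ℝ) * (1 - v)) ∂(muAlpha α) = 0 := by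
  intro u hu
  rw [aux_main α u hα1 hα2 hu]
  have k1 : b₁ * u ^ (r₁ - 2) = b₁ * u ^ (r₀ - 1) := by
    rcases hb₁.eq_or_lt with h | h
    · rw [← h]; simp
    · rw [hr₁ h]; congr 2; ring
  have k2 : b₂ * (u ^ r₂ * u ^ (-α)) = b₂ * u ^ (r₀ - 1) := by
    rcases hb₂.eq_or_lt with h | h
    · rw [← h]; simp
    · rw [hr₂ h, ← Real.rpow_add hu]; congr 2; ring
  rw [hb₀]
  linear_combination (1 / 2) * k1 + Real.Gamma α * k2
end

section
/- Let ρ > 0, let U ⊆ (0,∞) be a Borel set, let μ be a σ-finite Borel measure on U with ∫_U min(z,z^2) μ(dz) < ∞, let ν be a σ-finite Borel measure on (0,∞)∖U with ∫ max(1, ln(1+z)) ν(dz) < ∞, let a_0 : (0,∞) → ℝ and a_1, a_2, a_3 : (0,∞) → [0,∞) be functions, and let g(x) := (ln x)^{−ρ}. Then for every u > 3, Lg(u) ≤ ρ·(ln u)^{−ρ−1}·φ(u) + (ρ(ρ+1) + 1)·g(u)·H_ρ(u). -/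
open MeasureTheory

/-- The generator
`Lg(u) = a₀(u)g′(u) + ½a₁(u)g″(u) + a₂(u)∫_U [g(u+z)−g(u)−zg′(u)] μ(dz)
  + a₃(u)∫_{(0,∞)∖U} [g(u+z)−g(u)] ν(dz)`. -/
noncomputable def Lop (U : Set ℝ) (μ ν : Measure ℝ) (a₀ a₁ a₂ a₃ : ℝ → ℝ)
    (g : ℝ → ℝ) (u : ℝ) : ℝ :=
  a₀ u * deriv g u + (1 / 2) * a₁ u * deriv (deriv g) u
    + a₂ u * (∫ z in U, (g (u + z) - g u - z * deriv g u) ∂μ)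
    + a₃ u * (∫ z in Set.Ioi (0 : ℝ) \ U, (g (u + z) - g u) ∂ν)

/-- The function
`φ(u) = −a₀(u)u⁻¹ + ½a₁(u)u⁻² + a₂(u)∫_U z²(∫₀¹ (u+vz)⁻²(1−v) dv) μ(dz)
  − a₃(u)∫_{(0,∞)∖U} z(∫₀¹ (u+vz)⁻¹ dv) ν(dz)`. -/
noncomputable def phiFun (U : Set ℝ) (μ ν : Measure ℝ) (a₀ a₁ a₂ a₃ : ℝ → ℝ) (u : ℝ) : ℝ :=
  -a₀ u * u ^ (-1 : ℝ) + (1 / 2) * a₁ u * u ^ (-2 : ℝ)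
    + a₂ u * (∫ z in U, z ^ 2 * (∫ v in (0 : ℝ)..1, (u + v * z) ^ (-2 : ℝ) * (1 - v)) ∂μ)
    - a₃ u * (∫ z in Set.Ioi (0 : ℝ) \ U, z * (∫ v in (0 : ℝ)..1, (u + v * z) ^ (-1 : ℝ)) ∂ν)

/-- `H_ρ(u) = ½a₁(u)u⁻² + a₂(u)∫_U K_ρ(u,z) μ(dz) + a₃(u)∫_{(0,∞)∖U} K_ρ(u,z) ν(dz)`. -/
noncomputable def Hfun (ρ : ℝ) (U : Set ℝ) (μ ν : Measure ℝ) (a₁ a₂ a₃ : ℝ → ℝ) (u : ℝ) : ℝ :=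
  (1 / 2) * a₁ u * u ^ (-2 : ℝ) + a₂ u * (∫ z in U, Kfun ρ u z ∂μ)
    + a₃ u * (∫ z in Set.Ioi (0 : ℝ) \ U, Kfun ρ u z ∂ν)

lemma K_aux (ρ r : ℝ) (hρ : 0 < ρ) (hr : 1 ≤ r) :
    0 ≤ r ^ (-ρ) + ρ * r - (ρ + 1) ∧ r ^ (-ρ) + ρ * r - (ρ + 1) ≤ ρ * (r - 1) ∧
    r ^ (-ρ) + ρ * r - (ρ + 1) ≤ (ρ + ρ ^ 2) * (r - 1) ^ 2 := by
  have hr0 : 0 < r := by linarith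
  have hl0 : 0 ≤ Real.log r := Real.log_nonneg hr
  have hl1 : Real.log r ≤ r - 1 := Real.log_le_sub_one_of_pos hr0
  have hl2 : 1 - r⁻¹ ≤ Real.log r := Real.one_sub_inv_le_log_of_pos hr0
  have hl3 : (r - 1) - (r - 1) ^ 2 ≤ 1 - r⁻¹ := by
    have : 1 - r⁻¹ - ((r - 1) - (r - 1) ^ 2) = (r - 1) ^ 3 / r := by field_simp; ring
    have h2 : 0 ≤ (r - 1) ^ 3 / r := by
      have : 0 ≤ r - 1 := by linarith
      positivity
    linarith
  set x := ρ * Real.log r with hx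
  have hx0 : 0 ≤ x := by positivity
  have e : r ^ (-ρ) = Real.exp (-x) := by
    rw [Real.rpow_def_of_pos hr0]; congr 1; rw [hx]; ring
  have hxs : x ≤ ρ * (r - 1) := mul_le_mul_of_nonneg_left hl1 hρ.le
  have h1 : 1 - x ≤ Real.exp (-x) := by linarith [Real.add_one_le_exp (-x)]
  have h2 : Real.exp (-x) ≤ 1 := Real.exp_le_one_iff.2 (by linarith)
  have h3 : Real.exp (-x) ≤ 1 - x + x ^ 2 := by
    have := Real.add_one_le_exp x
    rw [Real.exp_neg]
    have h4 : (Real.exp x)⁻¹ ≤ (x + 1)⁻¹ := inv_anti₀ (by linarith) this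
    refine h4.trans ?_
    rw [inv_le_iff_one_le_mul₀ (by linarith)]
    nlinarith [pow_nonneg hx0 3]
  rw [e]
  refine ⟨by linarith, by linarith, ?_⟩
  have h5 : x ^ 2 ≤ (ρ * (r - 1)) ^ 2 := pow_le_pow_left₀ hx0 hxs 2
  have h6 : ρ * ((r - 1) - (r - 1) ^ 2) ≤ x := mul_le_mul_of_nonneg_left (hl3.trans hl2) hρ.le
  nlinarith

lemma log_gt_one {u : ℝ} (hu : 3 < u) : 1 < Real.log u := by
  rw [Real.lt_log_iff_exp_lt (by linarith)]
  linarith [Real.exp_one_lt_d9]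

lemma ratio_aux (u z : ℝ) (hu : 3 < u) (hz : 0 < z) :
    1 ≤ Real.log (u + z) / Real.log u ∧ Real.log (u + z) / Real.log u - 1 ≤ z ∧
    Real.log (u + z) / Real.log u - 1 ≤ Real.log (1 + z) ∧
    Real.log (u + z) - Real.log u ≤ Real.log (1 + z) ∧ Real.log u ≤ Real.log (u + z) := by
  have hl := log_gt_one hu
  have h1 : Real.log u ≤ Real.log (u + z) := Real.log_le_log (by linarith) (by linarith)
  have h2 : Real.log (u + z) ≤ Real.log u + Real.log (1 + z) := by
    rw [← Real.log_mul (by linarith) (by linarith)]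
    exact Real.log_le_log (by linarith) (by nlinarith)
  have h3 : Real.log (1 + z) ≤ z := by
    have := Real.log_le_sub_one_of_pos (x := 1 + z) (by linarith)
    linarith
  have h4 : 1 ≤ Real.log (u + z) / Real.log u := by rw [le_div_iff₀ (by linarith)]; linarith
  have h5 : Real.log (u + z) / Real.log u - 1 ≤ Real.log (1 + z) := by
    have : Real.log (u + z) / Real.log u - 1 = (Real.log (u + z) - Real.log u) / Real.log u := by
      field_simp
    rw [this, div_le_iff₀ (by linarith)]
    nlinarith
  exact ⟨h4, h5.trans h3, h5, by linarith, h1⟩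

lemma T_aux (u z : ℝ) (hu : 3 < u) (hz : 0 < z) :
    0 ≤ z / u - (Real.log (u + z) - Real.log u) ∧
    z / u - (Real.log (u + z) - Real.log u) ≤ min z (z ^ 2) := by
  have hu0 : 0 < u := by linarith
  have hq : 0 < (u + z) / u := by positivity
  have e : Real.log (u + z) - Real.log u = Real.log ((u + z) / u) := by
    rw [Real.log_div (by linarith) (by linarith)]
  have h1 := Real.log_le_sub_one_of_pos hq
  have h2 := Real.one_sub_inv_le_log_of_pos hq
  have e1 : (u + z) / u - 1 = z / u := by field_simp; ring
  have e2 : z / u - (1 - ((u + z) / u)⁻¹) = z ^ 2 / (u * (u + z)) := by field_simp; ring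
  have h3 : z ^ 2 / (u * (u + z)) ≤ z ^ 2 := div_le_self (by positivity) (by nlinarith)
  have h4 : z / u ≤ z := div_le_self hz.le (by linarith)
  have h5 := Real.log_le_log hu0 (show u ≤ u + z by linarith)
  rw [e1] at h1
  refine ⟨by linarith, le_min (by linarith) (by linarith)⟩

lemma int1 (u z : ℝ) (hu : 3 < u) (hz : 0 < z) :
    z * (∫ v in (0 : ℝ)..1, (u + v * z) ^ (-1 : ℝ)) = Real.log (u + z) - Real.log u := by
  have hpos : ∀ v ∈ Set.uIcc (0 : ℝ) 1, 0 < u + v * z := by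
    intro v hv
    rw [Set.uIcc_of_le zero_le_one] at hv
    have := mul_nonneg hv.1 hz.le
    linarith
  rw [← intervalIntegral.integral_const_mul]
  have := intervalIntegral.integral_eq_sub_of_hasDerivAt (a := 0) (b := 1)
    (f := fun v : ℝ => Real.log (u + v * z)) (f' := fun v : ℝ => z * (u + v * z) ^ (-1 : ℝ)) ?_ ?_
  · rw [this]; simp
  · intro v hv
    have h := hpos v hv
    have h1 : HasDerivAt (fun v : ℝ => u + v * z) z v := by
      simpa using ((hasDerivAt_id v).mul_const z).const_add u
    refine (h1.log h.ne').congr_deriv ?_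
    rw [Real.rpow_neg_one]; rfl
  · apply ContinuousOn.intervalIntegrable
    intro v hv
    apply ContinuousAt.continuousWithinAt
    have h := hpos v hv
    refine continuousAt_const.mul (ContinuousAt.rpow_const (by fun_prop) (Or.inl h.ne'))

lemma int2 (u z : ℝ) (hu : 3 < u) (hz : 0 < z) :
    z ^ 2 * (∫ v in (0 : ℝ)..1, (u + v * z) ^ (-2 : ℝ) * (1 - v)) =
      z / u - (Real.log (u + z) - Real.log u) := by
  have hpos : ∀ v ∈ Set.uIcc (0 : ℝ) 1, 0 < u + v * z := by
    intro v hv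
    rw [Set.uIcc_of_le zero_le_one] at hv
    have := mul_nonneg hv.1 hz.le
    linarith
  rw [← intervalIntegral.integral_const_mul]
  have := intervalIntegral.integral_eq_sub_of_hasDerivAt (a := 0) (b := 1)
    (f := fun v : ℝ => -((1 - v) * z / (u + v * z)) - Real.log (u + v * z))
    (f' := fun v : ℝ => z ^ 2 * ((u + v * z) ^ (-2 : ℝ) * (1 - v))) ?_ ?_
  · rw [this]; simp; ring
  · intro v hv
    have h := hpos v hv
    have h1 : HasDerivAt (fun v : ℝ => u + v * z) z v := by
      simpa using ((hasDerivAt_id v).mul_const z).const_add u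
    have h2 : HasDerivAt (fun v : ℝ => (1 - v) * z) (-z) v := by
      simpa using ((hasDerivAt_id v).const_sub 1).mul_const z
    have h3 := ((h2.div h1 h.ne').neg).sub (h1.log h.ne')
    refine h3.congr_deriv ?_
    rw [Real.rpow_neg h.le, Real.rpow_two]
    field_simp
    ring
  · apply ContinuousOn.intervalIntegrable
    intro v hv
    apply ContinuousAt.continuousWithinAt
    have h := hpos v hv
    refine continuousAt_const.mul (ContinuousAt.mul (ContinuousAt.rpow_const (by fun_prop) (Or.inl h.ne')) (by fun_prop))

lemma deriv1 (ρ x : ℝ) (hx : 1 < x) :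
    HasDerivAt (fun x : ℝ => Real.log x ^ (-ρ)) (-ρ * Real.log x ^ (-ρ - 1) / x) x := by
  have := (Real.hasDerivAt_log (show x ≠ 0 by linarith)).rpow_const (p := -ρ)
    (Or.inl (Real.log_pos hx).ne')
  convert this using 1
  field_simp

lemma deriv2 (ρ x : ℝ) (hx : 1 < x) :
    deriv (deriv (fun x : ℝ => Real.log x ^ (-ρ))) x =
      ρ * (ρ + 1) * Real.log x ^ (-ρ - 2) / x ^ 2 + ρ * Real.log x ^ (-ρ - 1) / x ^ 2 := by
  have hE : deriv (fun x : ℝ => Real.log x ^ (-ρ)) =ᶠ[nhds x]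
      fun x => -ρ * Real.log x ^ (-ρ - 1) / x := by
    filter_upwards [eventually_gt_nhds hx] with y hy using (deriv1 ρ y hy).deriv
  rw [hE.deriv_eq]
  have hx0 : x ≠ 0 := by linarith
  have h1 := (Real.hasDerivAt_log hx0).rpow_const (p := -ρ - 1) (Or.inl (Real.log_pos hx).ne')
  have h2 := (h1.const_mul (-ρ)).div (hasDerivAt_id x) hx0
  refine h2.deriv.trans ?_
  rw [show -ρ - 1 - 1 = -ρ - 2 by ring]
  simp only [id]
  field_simp
  ring

theorem stmt_15 (ρ : ℝ) (hρ : 0 < ρ) (U : Set ℝ) (hU : MeasurableSet U)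
    (hUsub : U ⊆ Set.Ioi 0) (μ ν : Measure ℝ) [SigmaFinite μ] [SigmaFinite ν]
    (hμ : Integrable (fun z => min z (z ^ 2)) (μ.restrict U))
    (hν : Integrable (fun z => max 1 (Real.log (1 + z))) (ν.restrict (Set.Ioi 0 \ U)))
    (a₀ a₁ a₂ a₃ : ℝ → ℝ) (ha₁ : ∀ u, 0 < u → 0 ≤ a₁ u) (ha₂ : ∀ u, 0 < u → 0 ≤ a₂ u)
    (ha₃ : ∀ u, 0 < u → 0 ≤ a₃ u)
    (g : ℝ → ℝ) (hg : ∀ x, g x = Real.log x ^ (-ρ)) :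
    ∀ u : ℝ, 3 < u →
      Lop U μ ν a₀ a₁ a₂ a₃ g u ≤
        ρ * Real.log u ^ (-ρ - 1) * phiFun U μ ν a₀ a₁ a₂ a₃ u
          + (ρ * (ρ + 1) + 1) * g u * Hfun ρ U μ ν a₁ a₂ a₃ u := by
  intro u hu
  obtain rfl : g = fun x => Real.log x ^ (-ρ) := funext hg
  have hl := log_gt_one hu
  have hl0 : 0 < Real.log u := by linarith
  have hu0 : 0 < u := by linarith
  have hV : MeasurableSet (Set.Ioi (0 : ℝ) \ U) := measurableSet_Ioi.diff hU
  set ℓ := Real.log u with hℓ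
  set G := ℓ ^ (-ρ) with hG
  have hG0 : 0 < G := Real.rpow_pos_of_pos hl0 _
  have hG1 : ℓ ^ (-ρ - 1) = G / ℓ := by rw [Real.rpow_sub hl0, Real.rpow_one]
  have hG2 : ℓ ^ (-ρ - 2) = G / ℓ ^ 2 := by rw [Real.rpow_sub hl0, Real.rpow_two]
  set C := ρ * (ρ + 1) + 1 with hC
  have hC1 : 1 ≤ C := by rw [hC]; nlinarith
  have hgz : ∀ z, 0 < z → Real.log (u + z) ^ (-ρ) = G * (Real.log (u + z) / ℓ) ^ (-ρ) := by
    intro z hz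
    have h5 : 0 ≤ Real.log (u + z) / ℓ := by linarith [(ratio_aux u z hu hz).1]
    rw [hG, ← Real.mul_rpow hl0.le h5]
    congr 1
    field_simp
  have hKm : Measurable (fun z => Kfun ρ u z) := by unfold Kfun; fun_prop
  have hKb : ∀ z, 0 < z → 0 ≤ Kfun ρ u z ∧ Kfun ρ u z ≤ (ρ + ρ ^ 2) * min z (z ^ 2) ∧
      Kfun ρ u z ≤ ρ * Real.log (1 + z) := by
    intro z hz
    obtain ⟨r1, r2, r3, -, -⟩ := ratio_aux u z hu hz
    obtain ⟨k1, k2, k3⟩ := K_aux ρ _ hρ r1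
    refine ⟨k1, ?_, k2.trans (mul_le_mul_of_nonneg_left r3 hρ.le)⟩
    rw [mul_min_of_nonneg _ _ (by positivity)]
    refine le_min ?_ ?_
    · refine k2.trans ((mul_le_mul_of_nonneg_left r2 hρ.le).trans ?_)
      nlinarith [mul_pos (pow_pos hρ 2) hz]
    · refine k3.trans (mul_le_mul_of_nonneg_left ?_ (by positivity))
      exact pow_le_pow_left₀ (by linarith) r2 2
  -- integrability
  have iK : Integrable (fun z => Kfun ρ u z) (μ.restrict U) := by
    refine (hμ.const_mul (ρ + ρ ^ 2)).mono' hKm.aestronglyMeasurable ?_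
    filter_upwards [ae_restrict_mem hU] with z hz
    obtain ⟨h1, h2, -⟩ := hKb z (hUsub hz)
    rwa [Real.norm_of_nonneg h1]
  have iT : Integrable (fun z => z / u - (Real.log (u + z) - ℓ)) (μ.restrict U) := by
    refine hμ.mono' (Measurable.aestronglyMeasurable (by fun_prop)) ?_
    filter_upwards [ae_restrict_mem hU] with z hz
    obtain ⟨h1, h2⟩ := T_aux u z hu (hUsub hz)
    rwa [Real.norm_of_nonneg h1]
  have iK' : Integrable (fun z => Kfun ρ u z) (ν.restrict (Set.Ioi 0 \ U)) := by
    refine (hν.const_mul ρ).mono' hKm.aestronglyMeasurable ?_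
    filter_upwards [ae_restrict_mem hV] with z hz
    obtain ⟨h1, -, h2⟩ := hKb z hz.1
    rw [Real.norm_of_nonneg h1]
    exact h2.trans (mul_le_mul_of_nonneg_left (le_max_right _ _) hρ.le)
  have iD : Integrable (fun z => Real.log (u + z) - ℓ) (ν.restrict (Set.Ioi 0 \ U)) := by
    refine hν.mono' (Measurable.aestronglyMeasurable (by fun_prop)) ?_
    filter_upwards [ae_restrict_mem hV] with z hz
    obtain ⟨-, -, -, h1, h2⟩ := ratio_aux u z hu hz.1
    rw [Real.norm_of_nonneg (by linarith)]
    exact h1.trans (le_max_right _ _)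
  have hK0 : 0 ≤ ∫ z in U, Kfun ρ u z ∂μ :=
    setIntegral_nonneg hU fun z hz => (hKb z (hUsub hz)).1
  have hK0' : 0 ≤ ∫ z in Set.Ioi (0 : ℝ) \ U, Kfun ρ u z ∂ν :=
    setIntegral_nonneg hV fun z hz => (hKb z hz.1).1
  have hd1 := (deriv1 ρ u (by linarith)).deriv
  have hd2 := deriv2 ρ u (by linarith)
  have e1 : ∫ z in U, z ^ 2 * (∫ v in (0 : ℝ)..1, (u + v * z) ^ (-2 : ℝ) * (1 - v)) ∂μ
      = ∫ z in U, (z / u - (Real.log (u + z) - ℓ)) ∂μ :=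
    setIntegral_congr_fun hU fun z hz => int2 u z hu (hUsub hz)
  have e2 : ∫ z in Set.Ioi (0 : ℝ) \ U, z * (∫ v in (0 : ℝ)..1, (u + v * z) ^ (-1 : ℝ)) ∂ν
      = ∫ z in Set.Ioi (0 : ℝ) \ U, (Real.log (u + z) - ℓ) ∂ν :=
    setIntegral_congr_fun hV fun z hz => int1 u z hu hz.1
  have e3 : ∫ z in U, (Real.log (u + z) ^ (-ρ) - G - z * (-ρ * (G / ℓ) / u)) ∂μ
      = ρ * (G / ℓ) * (∫ z in U, (z / u - (Real.log (u + z) - ℓ)) ∂μ)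
        + G * ∫ z in U, Kfun ρ u z ∂μ := by
    rw [← integral_const_mul, ← integral_const_mul,
      ← integral_add (iT.const_mul _) (iK.const_mul _)]
    refine setIntegral_congr_fun hU fun z hz => ?_
    simp only [hgz z (hUsub hz), Kfun, ← hℓ]
    field_simp
    ring
  have e4 : ∫ z in Set.Ioi (0 : ℝ) \ U, (Real.log (u + z) ^ (-ρ) - G) ∂ν
      = -(ρ * (G / ℓ)) * (∫ z in Set.Ioi (0 : ℝ) \ U, (Real.log (u + z) - ℓ) ∂ν)
        + G * ∫ z in Set.Ioi (0 : ℝ) \ U, Kfun ρ u z ∂ν := by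
    rw [← integral_const_mul, ← integral_const_mul,
      ← integral_add (iD.const_mul _) (iK'.const_mul _)]
    refine setIntegral_congr_fun hV fun z hz => ?_
    simp only [hgz z hz.1, Kfun, ← hℓ]
    field_simp
    ring
  unfold Lop phiFun Hfun
  rw [hd1, hd2, e1, e2]
  simp only [← hℓ, ← hG, hG1, hG2]
  rw [e3, e4, Real.rpow_neg_one, Real.rpow_neg hu0.le, Real.rpow_two]
  generalize (∫ z in U, (z / u - (Real.log (u + z) - ℓ)) ∂μ) = I1
  generalize (∫ z in Set.Ioi (0 : ℝ) \ U, (Real.log (u + z) - ℓ) ∂ν) = I2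
  generalize (∫ z in U, Kfun ρ u z ∂μ) = J1 at *
  generalize (∫ z in Set.Ioi (0 : ℝ) \ U, Kfun ρ u z ∂ν) = J2 at *
  have t1 : 0 ≤ (C - 1) * (a₂ u * (G * J1)) :=
    mul_nonneg (by linarith) (mul_nonneg (ha₂ u hu0) (by positivity))
  have t2 : 0 ≤ (C - 1) * (a₃ u * (G * J2)) :=
    mul_nonneg (by linarith) (mul_nonneg (ha₃ u hu0) (by positivity))
  have t3 : 0 ≤ (1 / 2) * a₁ u * (u ^ 2)⁻¹ * (C * G - ρ * (ρ + 1) * (G / ℓ ^ 2)) := by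
    have h1 : G / ℓ ^ 2 ≤ G := div_le_self hG0.le (by nlinarith)
    have h2 : ρ * (ρ + 1) * (G / ℓ ^ 2) ≤ ρ * (ρ + 1) * G :=
      mul_le_mul_of_nonneg_left h1 (by positivity)
    have h3 := ha₁ u hu0
    refine mul_nonneg (by positivity) ?_
    rw [hC]; nlinarith
  rw [← sub_nonneg]
  refine (add_nonneg (add_nonneg t1 t2) t3).trans_eq ?_
  simp only [div_eq_mul_inv]
  ring
end
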